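/- Let φ ∈ 𝒟(ℝⁿ) with supp φ ⊆ (−1,1)ⁿ and Σ_{𝐧∈ℤⁿ} φ(x−𝐧) = 1 for all x, and let χ ∈ 𝒮^*_†(ℝⁿ) with ∫χ = 1. Define ψ := φ * χ. Then the family {T_𝐧ψ}_{𝐧∈ℤⁿ} is a uniformly concentrated partition of unity of class *−† with points {𝐧}_{𝐧∈ℤⁿ}: it satisfies (1) uniform bounds sup_𝐧 sup_α sup_x h^{|α|}|∂^α(T_𝐧ψ)(x)| e^{A(h|x−𝐧|)}/M_{|α|} < ∞ for all h > 0 (Beurling) or some h > 0 (Roumieu), (2) bounded overlap of {𝐧 + K} for every compact K, (3) ℝⁿ = ∪_𝐧 (𝐧 + U) for a bounded open U ∋ 0, and (4) Σ_𝐧 T_𝐧ψ(x) = 1 for all x ∈ ℝⁿ. -/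

import Mathlib

open MeasureTheory

noncomputable section

/-- Partial derivative in the `i`-th coordinate direction. -/
def pDeriv {n : ℕ} (i : Fin n)
    (f : EuclideanSpace ℝ (Fin n) → ℂ) : EuclideanSpace ℝ (Fin n) → ℂ :=
  fun x => fderiv ℝ f x (EuclideanSpace.single i (1 : ℝ))

/-- The multi-index derivative `∂^α f`. -/
def multiDeriv {n : ℕ} (α : Fin n → ℕ)
    (f : EuclideanSpace ℝ (Fin n) → ℂ) : EuclideanSpace ℝ (Fin n) → ℂ :=
  (List.finRange n).foldr (fun i g => (pDeriv i)^[α i] g) f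

/-- The lattice point `𝐧 ∈ ℤⁿ` viewed as a point of `ℝⁿ`. -/
def latticePt (n : ℕ) (k : Fin n → ℤ) : EuclideanSpace ℝ (Fin n) :=
  (WithLp.equiv 2 (Fin n → ℝ)).symm fun i => (k i : ℝ)

end

lemma latticePt_apply (n : ℕ) (k : Fin n → ℤ) (i : Fin n) : latticePt n k i = (k i : ℝ) := rfl

lemma EuclideanSpace.norm_le_sqrt_of_abs_le_one {n : ℕ} {x : EuclideanSpace ℝ (Fin n)}
    (hx : ∀ i, |x i| ≤ 1) : ‖x‖ ≤ √n := by
  rw [EuclideanSpace.norm_eq]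
  refine Real.sqrt_le_sqrt ?_
  calc ∑ i, ‖x i‖ ^ 2 ≤ ∑ _i : Fin n, (1 : ℝ) :=
        Finset.sum_le_sum fun i _ => pow_le_one₀ (norm_nonneg _) (hx i)
    _ = n := by simp

/-- The finite set of lattice indices whose points lie in the cube of half-side `R` about `x`. -/
noncomputable def latticeBox {n : ℕ} (x : EuclideanSpace ℝ (Fin n)) (R : ℝ) : Finset (Fin n → ℤ) :=
  Fintype.piFinset fun i => Finset.Icc ⌈x i - R⌉ ⌊x i + R⌋

lemma mem_latticeBox {n : ℕ} {x : EuclideanSpace ℝ (Fin n)} {R : ℝ} {k : Fin n → ℤ}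
    (hk : ‖x - latticePt n k‖ ≤ R) : k ∈ latticeBox x R := by
  refine Fintype.mem_piFinset.2 fun i => Finset.mem_Icc.2 ?_
  have h := (PiLp.norm_apply_le (x - latticePt n k) i).trans hk
  rw [PiLp.sub_apply, latticePt_apply, Real.norm_eq_abs, abs_le] at h
  exact ⟨Int.ceil_le.2 (by linarith), Int.le_floor.2 (by linarith)⟩

lemma card_latticeBox_le {n : ℕ} (x : EuclideanSpace ℝ (Fin n)) {R : ℝ} (hR : 0 ≤ R) :
    ((latticeBox x R).card : ℝ) ≤ (2 * R + 1) ^ n := by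
  rw [latticeBox, Fintype.card_piFinset, Nat.cast_prod]
  calc ∏ i, ((Finset.Icc ⌈x i - R⌉ ⌊x i + R⌋).card : ℝ) ≤ ∏ _i : Fin n, (2 * R + 1) := by
        refine Finset.prod_le_prod (fun i _ => by positivity) fun i _ => ?_
        rw [Int.card_Icc, ← Int.cast_natCast, Int.toNat_eq_max, Int.cast_max]
        refine max_le ?_ (by push_cast; linarith)
        push_cast
        linarith [Int.floor_le (x i + R), Int.le_ceil (x i - R)]
    _ = (2 * R + 1) ^ n := by simp

section Deriv

variable {n : ℕ}

lemma ContDiff.pDeriv {f : EuclideanSpace ℝ (Fin n) → ℂ} (hf : ContDiff ℝ (⊤ : ℕ∞) f)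
    (i : Fin n) : ContDiff ℝ (⊤ : ℕ∞) (pDeriv i f) :=
  (hf.fderiv_right (by simp)).clm_apply contDiff_const

lemma pDeriv_comp_sub (i : Fin n) (f : EuclideanSpace ℝ (Fin n) → ℂ)
    (a : EuclideanSpace ℝ (Fin n)) :
    pDeriv i (fun t => f (t - a)) = fun t => pDeriv i f (t - a) := by
  ext x
  simp [pDeriv, fderiv_comp_sub]

/-- A relation between functions that is preserved by every partial derivative is preserved by
every multi-index derivative. -/
lemma multiDeriv_induction
    {P : (EuclideanSpace ℝ (Fin n) → ℂ) → (EuclideanSpace ℝ (Fin n) → ℂ) → Prop}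
    (hP : ∀ i f g, P f g → P (pDeriv i f) (pDeriv i g)) (α : Fin n → ℕ)
    {f g : EuclideanSpace ℝ (Fin n) → ℂ} (h : P f g) : P (multiDeriv α f) (multiDeriv α g) := by
  unfold multiDeriv
  induction List.finRange n with
  | nil => exact h
  | cons i l ih =>
    rw [List.foldr_cons, List.foldr_cons]
    induction α i with
    | zero => exact ih
    | succ m ihm =>
      rw [Function.iterate_succ_apply', Function.iterate_succ_apply']
      exact hP _ _ _ ihm

lemma multiDeriv_zero (f : EuclideanSpace ℝ (Fin n) → ℂ) : multiDeriv (0 : Fin n → ℕ) f = f := by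
  unfold multiDeriv
  induction List.finRange n with
  | nil => rfl
  | cons i l ih => rw [List.foldr_cons, ih]; rfl

lemma multiDeriv_comp_sub (α : Fin n → ℕ) (f : EuclideanSpace ℝ (Fin n) → ℂ)
    (a : EuclideanSpace ℝ (Fin n)) :
    multiDeriv α (fun t => f (t - a)) = fun t => multiDeriv α f (t - a) :=
  multiDeriv_induction (P := fun u v => u = fun t => v (t - a))
    (fun i u v h => by rw [h, pDeriv_comp_sub]) α rfl

lemma hasFDerivAt_integral_mul_comp_sub {φ χ : EuclideanSpace ℝ (Fin n) → ℂ}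
    (hφ : Continuous φ) (hφc : HasCompactSupport φ) (hχ : ContDiff ℝ 1 χ)
    (x₀ : EuclideanSpace ℝ (Fin n)) :
    HasFDerivAt (fun x => ∫ t, φ t * χ (x - t)) (∫ t, φ t • fderiv ℝ χ (x₀ - t)) x₀ := by
  have hχ' : Continuous (fderiv ℝ χ) := hχ.continuous_fderiv one_ne_zero
  have hK : IsCompact (Metric.closedBall x₀ 1 ×ˢ tsupport φ) :=
    (isCompact_closedBall x₀ 1).prod hφc
  obtain ⟨C, hC⟩ := hK.exists_bound_of_continuousOn
    (f := fun p : _ × _ => fderiv ℝ χ (p.1 - p.2)) (by fun_prop)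
  have hcχ := hχ.continuous
  refine hasFDerivAt_integral_of_dominated_of_fderiv_le (s := Metric.closedBall x₀ 1)
    (bound := fun t => ‖φ t‖ * C) (F' := fun x t => φ t • fderiv ℝ χ (x - t))
    (Metric.closedBall_mem_nhds x₀ one_pos)
    (.of_forall fun x => Continuous.aestronglyMeasurable (by fun_prop))
    (Continuous.integrable_of_hasCompactSupport (by fun_prop) hφc.mul_right)
    (Continuous.aestronglyMeasurable (by fun_prop)) (.of_forall fun t x hx => ?_)
    ((hφ.integrable_of_hasCompactSupport hφc).norm.mul_const C)
    (.of_forall fun t x _ => ?_)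
  · rw [norm_smul]
    by_cases ht : t ∈ tsupport φ
    · exact mul_le_mul_of_nonneg_left (hC (x, t) ⟨hx, ht⟩) (norm_nonneg _)
    · simp [image_eq_zero_of_notMem_tsupport ht]
  · have h := ((hχ.differentiable one_ne_zero) (x - t)).hasFDerivAt.comp x
      ((hasFDerivAt_id x).sub_const t)
    exact h.const_mul (φ t)

lemma pDeriv_integral_mul_comp_sub {φ χ : EuclideanSpace ℝ (Fin n) → ℂ}
    (hφ : Continuous φ) (hφc : HasCompactSupport φ) (hχ : ContDiff ℝ 1 χ) (i : Fin n) :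
    pDeriv i (fun x => ∫ t, φ t * χ (x - t)) = fun x => ∫ t, φ t * pDeriv i χ (x - t) := by
  ext x
  have hχ' : Continuous (fderiv ℝ χ) := hχ.continuous_fderiv one_ne_zero
  rw [pDeriv, (hasFDerivAt_integral_mul_comp_sub hφ hφc hχ x).fderiv,
    ContinuousLinearMap.integral_apply
      (Continuous.integrable_of_hasCompactSupport (by fun_prop) hφc.smul_right)]
  rfl

lemma multiDeriv_integral_mul_comp_sub {φ χ : EuclideanSpace ℝ (Fin n) → ℂ}
    (hφ : Continuous φ) (hφc : HasCompactSupport φ) (hχ : ContDiff ℝ (⊤ : ℕ∞) χ)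
    (α : Fin n → ℕ) :
    multiDeriv α (fun x => ∫ t, φ t * χ (x - t)) =
      fun x => ∫ t, φ t * multiDeriv α χ (x - t) :=
  (multiDeriv_induction
    (P := fun u v => ContDiff ℝ (⊤ : ℕ∞) v ∧ u = fun x => ∫ t, φ t * v (x - t))
    (fun i u v h => ⟨h.1.pDeriv i, by
      rw [h.2, pDeriv_integral_mul_comp_sub hφ hφc (h.1.of_le (by simp))]⟩) α ⟨hχ, rfl⟩).2

end Deriv

/-- Convolution with an integrable function supported in a ball preserves a weighted bound, at the
cost of halving the scale of the weight. -/
lemma norm_integral_mul_comp_sub_mul_exp_le {E : Type*} [NormedAddCommGroup E] [MeasurableSpace E]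
    {μ : Measure E} {A : ℝ → ℝ}
    (hA_mono : ∀ a b : ℝ, 0 ≤ a → a ≤ b → A a ≤ A b)
    (hA_sub : ∀ ρ lam : ℝ, 0 ≤ ρ → 0 ≤ lam →
      Real.exp (A (ρ + lam)) ≤ 2 * Real.exp (A (2 * ρ)) * Real.exp (A (2 * lam)))
    {φ g : E → ℂ} (hφ : Integrable φ μ) {R : ℝ} (hR : ∀ t, φ t ≠ 0 → ‖t‖ ≤ R)
    {h D : ℝ} (hh : 0 ≤ h) (hg : ∀ x, ‖g x‖ * Real.exp (A (2 * h * ‖x‖)) ≤ D) (x : E) :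
    ‖∫ t, φ t * g (x - t) ∂μ‖ * Real.exp (A (h * ‖x‖)) ≤
      2 * Real.exp (A (2 * h * R)) * (∫ t, ‖φ t‖ ∂μ) * D := by
  have key : ∀ t, ‖Real.exp (A (h * ‖x‖)) • (φ t * g (x - t))‖ ≤
      ‖φ t‖ * (2 * Real.exp (A (2 * h * R)) * D) := by
    intro t
    rcases eq_or_ne (φ t) 0 with ht | ht
    · simp [ht]
    have h1 : Real.exp (A (h * ‖x‖)) ≤
        2 * Real.exp (A (2 * h * R)) * Real.exp (A (2 * h * ‖x - t‖)) := by
      have hx : h * ‖x‖ ≤ h * ‖t‖ + h * ‖x - t‖ := by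
        rw [← mul_add]
        gcongr
        simpa using norm_add_le t (x - t)
      calc Real.exp (A (h * ‖x‖)) ≤ Real.exp (A (h * ‖t‖ + h * ‖x - t‖)) :=
            Real.exp_le_exp.2 (hA_mono _ _ (by positivity) hx)
        _ ≤ 2 * Real.exp (A (2 * (h * ‖t‖))) * Real.exp (A (2 * (h * ‖x - t‖))) :=
            hA_sub _ _ (by positivity) (by positivity)
        _ ≤ 2 * Real.exp (A (2 * h * R)) * Real.exp (A (2 * h * ‖x - t‖)) := by
            rw [← mul_assoc 2 h, ← mul_assoc 2 h]
            have := hA_mono _ _ (by positivity)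
              (mul_le_mul_of_nonneg_left (hR t ht) (by positivity : 0 ≤ 2 * h))
            gcongr
    rw [norm_smul, norm_mul, Real.norm_of_nonneg (Real.exp_pos _).le]
    calc Real.exp (A (h * ‖x‖)) * (‖φ t‖ * ‖g (x - t)‖)
        ≤ (2 * Real.exp (A (2 * h * R)) * Real.exp (A (2 * h * ‖x - t‖))) *
            (‖φ t‖ * ‖g (x - t)‖) := by gcongr
      _ = ‖φ t‖ * (2 * Real.exp (A (2 * h * R)) *
            (‖g (x - t)‖ * Real.exp (A (2 * h * ‖x - t‖)))) := by ring
      _ ≤ _ := by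
          have := hg (x - t)
          gcongr
  calc ‖∫ t, φ t * g (x - t) ∂μ‖ * Real.exp (A (h * ‖x‖))
      = ‖∫ t, Real.exp (A (h * ‖x‖)) • (φ t * g (x - t)) ∂μ‖ := by
        rw [integral_smul, norm_smul, Real.norm_of_nonneg (Real.exp_pos _).le, mul_comm]
    _ ≤ ∫ t, ‖φ t‖ * (2 * Real.exp (A (2 * h * R)) * D) ∂μ :=
        norm_integral_le_of_norm_le (hφ.norm.mul_const _) (.of_forall key)
    _ = _ := by rw [integral_mul_const]; ring

/-- The lattice translates of `φ * χ` sum to `∫ χ` if those of `φ` sum to one. -/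
lemma hasSum_integral_mul_comp_sub_latticePt {n : ℕ} {φ χ : EuclideanSpace ℝ (Fin n) → ℂ}
    (hφ : Continuous φ) (hφc : HasCompactSupport φ) {R : ℝ} (hR0 : 0 ≤ R)
    (hR : ∀ t, φ t ≠ 0 → ‖t‖ ≤ R)
    (hφPU : ∀ x, HasSum (fun k : Fin n → ℤ => φ (x - latticePt n k)) 1)
    (hχ : Integrable χ) (x : EuclideanSpace ℝ (Fin n)) :
    HasSum (fun k : Fin n → ℤ => ∫ t, φ t * χ (x - latticePt n k - t)) (∫ t, χ t) := by
  obtain ⟨B, hB⟩ := hφc.exists_bound_of_continuous hφ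
  have hB0 : 0 ≤ B := (norm_nonneg _).trans (hB 0)
  have hshift : ∀ k : Fin n → ℤ, ∫ t, φ t * χ (x - latticePt n k - t) =
      ∫ s, φ (s - latticePt n k) * χ (x - s) := fun k => by
    rw [← integral_sub_right_eq_self (fun t => φ t * χ (x - latticePt n k - t)) (latticePt n k)]
    simp
  simp_rw [hshift]
  rw [← integral_sub_left_eq_self χ volume x]
  have hχx : Integrable fun s => χ (x - s) := hχ.comp_sub_left x
  have hzero : ∀ s, ∀ k ∉ latticeBox s R, ‖φ (s - latticePt n k)‖ = 0 := fun s k hk => by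
    by_contra h
    exact hk (mem_latticeBox (hR _ (norm_ne_zero_iff.1 h)))
  have hsum : ∀ s, Summable fun k : Fin n → ℤ => ‖φ (s - latticePt n k)‖ := fun s =>
    (hasSum_sum_of_ne_finset_zero (hzero s)).summable
  have htsum : ∀ s, ‖∑' k : Fin n → ℤ, ‖φ (s - latticePt n k)‖‖ ≤ (2 * R + 1) ^ n * B := by
    intro s
    rw [Real.norm_of_nonneg (tsum_nonneg fun _ => norm_nonneg _), tsum_eq_sum (hzero s)]
    calc ∑ k ∈ latticeBox s R, ‖φ (s - latticePt n k)‖ ≤ (latticeBox s R).card • B :=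
          Finset.sum_le_card_nsmul _ _ _ fun k _ => hB _
      _ ≤ (2 * R + 1) ^ n * B := by
          rw [nsmul_eq_mul]
          exact mul_le_mul_of_nonneg_right (card_latticeBox_le s hR0) hB0
  refine hasSum_integral_of_dominated_convergence
    (fun k s => ‖φ (s - latticePt n k)‖ * ‖χ (x - s)‖) (fun k => ?_)
    (fun k => .of_forall fun s => (norm_mul _ _).le)
    (.of_forall fun s => (hsum s).mul_right _) ?_
    (.of_forall fun s => by simpa using (hφPU s).mul_right (χ (x - s)))
  · exact Continuous.aestronglyMeasurable (by fun_prop) |>.mul hχx.aestronglyMeasurable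
  · simp_rw [tsum_mul_right]
    refine hχx.norm.bdd_mul (c := (2 * R + 1) ^ n * B) ?_ (.of_forall htsum)
    exact (Measurable.tsum fun k => Continuous.measurable (by fun_prop)).aestronglyMeasurable

/-!
STATEMENT 19.  Let `φ ∈ 𝒟(ℝⁿ)` with `supp φ ⊆ (−1,1)ⁿ` and `Σ_𝐧 φ(x−𝐧) = 1`, and let
`χ ∈ 𝒮^*_†(ℝⁿ)` with `∫χ = 1`; `χ`'s membership of `𝒮^*_†` is expressed by the
ultradifferentiable decay bounds `h^{|α|}|∂^αχ(x)|e^{A(h|x|)} ≤ C_h M_{|α|}` for all `h > 0`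
(Beurling case) or some `h > 0` (Roumieu case).  Then `ψ := φ * χ` (convolution) generates
the uniformly concentrated partition of unity `{T_𝐧ψ}_{𝐧∈ℤⁿ}` of class `*−†` with points
`{𝐧}`: (1) the uniform decay bounds hold for all (resp. some) `h > 0`, (2) the translates
of any compact set have bounded overlap, (3) `ℝⁿ = ∪_𝐧 (𝐧 + U)` for a bounded open
`U ∋ 0`, and (4) `Σ_𝐧 T_𝐧ψ(x) = 1` for every `x`. -/
theorem stmt_19 (n : ℕ) (hn : 0 < n) (M : ℕ → ℝ) (hMpos : ∀ p, 0 < M p) (hM0 : M 0 = 1)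
    (A : ℝ → ℝ)
    (hA_nonneg : ∀ a : ℝ, 0 ≤ a → 0 ≤ A a)
    (hA_mono : ∀ a b : ℝ, 0 ≤ a → a ≤ b → A a ≤ A b)
    (hA_sub : ∀ ρ lam : ℝ, 0 ≤ ρ → 0 ≤ lam →
      Real.exp (A (ρ + lam)) ≤ 2 * Real.exp (A (2 * ρ)) * Real.exp (A (2 * lam)))
    (φ : EuclideanSpace ℝ (Fin n) → ℂ) (hφsm : ContDiff ℝ (⊤ : ℕ∞) φ)
    (hφsupp : ∀ x : EuclideanSpace ℝ (Fin n),
      (∃ i : Fin n, 1 ≤ |x i|) → φ x = 0)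
    (hφPU : ∀ x : EuclideanSpace ℝ (Fin n),
      HasSum (fun k : Fin n → ℤ => φ (x - latticePt n k)) 1)
    (χ : EuclideanSpace ℝ (Fin n) → ℂ) (hχsm : ContDiff ℝ (⊤ : ℕ∞) χ)
    (hχint : ∫ x : EuclideanSpace ℝ (Fin n), χ x = 1)
    (hχloc : ∀ α : Fin n → ℕ, Integrable (multiDeriv α χ))
    (ψ : EuclideanSpace ℝ (Fin n) → ℂ)
    (hψ : ∀ x : EuclideanSpace ℝ (Fin n),
      ψ x = ∫ t : EuclideanSpace ℝ (Fin n), φ t * χ (x - t)) :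
    -- (1) uniform ultradifferentiable decay bounds: Beurling case ...
    ((∀ h > (0:ℝ), ∃ Cχ : ℝ, ∀ (α : Fin n → ℕ) (x : EuclideanSpace ℝ (Fin n)),
        ‖multiDeriv α χ x‖ * Real.exp (A (h * ‖x‖)) ≤ Cχ * M (∑ i, α i) / h ^ (∑ i, α i)) →
      ∀ h > (0:ℝ), ∃ Cψ : ℝ, ∀ (k : Fin n → ℤ) (α : Fin n → ℕ)
          (x : EuclideanSpace ℝ (Fin n)),
        ‖multiDeriv α (fun t => ψ (t - latticePt n k)) x‖ *
            Real.exp (A (h * ‖x - latticePt n k‖)) ≤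
          Cψ * M (∑ i, α i) / h ^ (∑ i, α i)) ∧
    -- ... and Roumieu case
    ((∃ h > (0:ℝ), ∃ Cχ : ℝ, ∀ (α : Fin n → ℕ) (x : EuclideanSpace ℝ (Fin n)),
        ‖multiDeriv α χ x‖ * Real.exp (A (h * ‖x‖)) ≤ Cχ * M (∑ i, α i) / h ^ (∑ i, α i)) →
      ∃ h > (0:ℝ), ∃ Cψ : ℝ, ∀ (k : Fin n → ℤ) (α : Fin n → ℕ)
          (x : EuclideanSpace ℝ (Fin n)),
        ‖multiDeriv α (fun t => ψ (t - latticePt n k)) x‖ *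
            Real.exp (A (h * ‖x - latticePt n k‖)) ≤
          Cψ * M (∑ i, α i) / h ^ (∑ i, α i)) ∧
    -- (2) bounded overlap of {𝐧 + K} for every compact K
    (∀ K : Set (EuclideanSpace ℝ (Fin n)), IsCompact K →
      ∃ CK : ℝ, ∀ x, ∃ hfin : {k : Fin n → ℤ | x - latticePt n k ∈ K}.Finite,
        (hfin.toFinset.card : ℝ) ≤ CK) ∧
    -- (3) covering by translates of a bounded open neighbourhood of 0
    (∃ U : Set (EuclideanSpace ℝ (Fin n)), IsOpen U ∧ Bornology.IsBounded U ∧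
      (0 : EuclideanSpace ℝ (Fin n)) ∈ U ∧
      ∀ x, ∃ k : Fin n → ℤ, x - latticePt n k ∈ U) ∧
    -- (4) Σ_𝐧 T_𝐧ψ = 1 pointwise
    (∀ x : EuclideanSpace ℝ (Fin n),
      HasSum (fun k : Fin n → ℤ => ψ (x - latticePt n k)) 1) := by
  have hR : ∀ t, φ t ≠ 0 → ‖t‖ ≤ √n := fun t ht =>
    EuclideanSpace.norm_le_sqrt_of_abs_le_one fun i => by
      by_contra! h
      exact ht (hφsupp t ⟨i, h.le⟩)
  have hφ : Continuous φ := hφsm.continuous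
  have hφc : HasCompactSupport φ :=
    HasCompactSupport.intro (isCompact_closedBall 0 √n) fun t ht => by
      by_contra h
      exact ht (mem_closedBall_zero_iff.2 (hR t h))
  have hψ_eq : ψ = fun x => ∫ t, φ t * χ (x - t) := funext hψ
  have bound : ∀ h > (0 : ℝ), (∃ Cχ : ℝ, ∀ (α : Fin n → ℕ) (x : EuclideanSpace ℝ (Fin n)),
      ‖multiDeriv α χ x‖ * Real.exp (A (2 * h * ‖x‖)) ≤
        Cχ * M (∑ i, α i) / (2 * h) ^ (∑ i, α i)) →
      ∃ Cψ : ℝ, ∀ (k : Fin n → ℤ) (α : Fin n → ℕ) (x : EuclideanSpace ℝ (Fin n)),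
        ‖multiDeriv α (fun t => ψ (t - latticePt n k)) x‖ *
            Real.exp (A (h * ‖x - latticePt n k‖)) ≤
          Cψ * M (∑ i, α i) / h ^ (∑ i, α i) := by
    rintro h hh ⟨C, hC⟩
    have hC0 : 0 ≤ C := by
      have := (by positivity : (0 : ℝ) ≤ _).trans (hC 0 0)
      simpa [hM0] using this
    refine ⟨2 * Real.exp (A (2 * h * √n)) * (∫ t, ‖φ t‖) * C, fun k α x => ?_⟩
    rw [multiDeriv_comp_sub, hψ_eq, multiDeriv_integral_mul_comp_sub hφ hφc hχsm]
    refine (norm_integral_mul_comp_sub_mul_exp_le hA_mono hA_sub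
      (hφ.integrable_of_hasCompactSupport hφc) hR hh.le (hC α) (x - latticePt n k)).trans ?_
    have hM := (hMpos (∑ i, α i)).le
    rw [mul_assoc _ C, mul_div_assoc _ (C * _)]
    gcongr
    linarith
  refine ⟨fun H h hh => bound h hh (H (2 * h) (by positivity)), ?_, ?_, ?_, ?_⟩
  · rintro ⟨h, hh, H⟩
    refine ⟨h / 2, by positivity, bound (h / 2) (by positivity) ?_⟩
    rwa [mul_div_cancel₀ h two_ne_zero]
  · intro K hK
    obtain ⟨R, hR0, hKR⟩ := hK.isBounded.exists_pos_norm_le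
    have hsub : ∀ x : EuclideanSpace ℝ (Fin n),
        {k : Fin n → ℤ | x - latticePt n k ∈ K} ⊆ latticeBox x R :=
      fun x k hk => mem_latticeBox (hKR _ hk)
    refine ⟨(2 * R + 1) ^ n, fun x => ⟨(latticeBox x R).finite_toSet.subset (hsub x), ?_⟩⟩
    refine le_trans ?_ (card_latticeBox_le x hR0.le)
    exact_mod_cast Finset.card_le_card (Set.Finite.toFinset_subset.2 (hsub x))
  · refine ⟨Metric.ball 0 (√n + 1), Metric.isOpen_ball, Metric.isBounded_ball,
      Metric.mem_ball_self (by positivity), fun x => ⟨fun i => ⌊x i⌋, ?_⟩⟩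
    refine mem_ball_zero_iff.2 (lt_of_le_of_lt ?_ (lt_add_one _))
    refine EuclideanSpace.norm_le_sqrt_of_abs_le_one fun i => ?_
    rw [PiLp.sub_apply, latticePt_apply, Int.self_sub_floor, abs_of_nonneg (Int.fract_nonneg _)]
    exact (Int.fract_lt_one _).le
  · intro x
    have hχ : Integrable χ := by simpa only [multiDeriv_zero] using hχloc 0
    simpa only [hψ, hχint] using hasSum_integral_mul_comp_sub_latticePt hφ hφc (Real.sqrt_nonneg n) hR
      hφPU hχ x
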